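/- arXiv:2007.10886 — 3 statements merged into one kernel-verified Lean document; each statement's English description precedes it below -/
import Mathlib

section
/- Recurrence property of the Izergin–Korepin type determinant (Property 3 of Properties 3.1, verified for the explicit determinant in the proof of Proposition 3.4). Let N ≥ 2 and q, γ, s_0 ∈ ℂ, ξ_0 ∈ ℂ∖{0}. For n ≥ 1 and complex numbers u_1,…,u_n (pairwise distinct) and v_1,…,v_n (pairwise distinct), define E_n(u_1,…,u_n; v_1,…,v_n) = det[ n(u_i,v_j) · ∏_{l=1, l≠j}^{n} (1−u_iv_l)(1−qu_iv_l) ]_{i,j=1}^n / ∏_{1≤i<j≤n}(u_i−u_j)(v_i−v_j), where n(u,v) = (1−γ)(q−γs_0²)(1−uv) + (1−q)(1−γξ_0s_0u)(1−γξ_0^{−1}s_0v). Let v_1,…,v_N be pairwise distinct with v_1 ≠ 0, and let u_2,…,u_N be pairwise distinct complex numbers, each different from 1/v_1. Then E_N(1/v_1, u_2,…,u_N; v_1,…,v_N) = (1−q)(1−s_0ξ_0γ/v_1)(1−s_0ξ_0^{−1}γv_1) · ∏_{j=2}^N (1−qv_j/v_1)(1−qv_1u_j) · E_{N−1}(u_2,…,u_N;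 v_2,…,v_N). -/
open scoped BigOperators

noncomputable section

/-- The Vandermonde-type product `∏_{1 ≤ i < j ≤ n} (w i − w j)`. -/
def vandP {n : ℕ} (w : Fin n → ℂ) : ℂ :=
  ∏ p ∈ Finset.univ.filter (fun p : Fin n × Fin n => p.1 < p.2), (w p.1 - w p.2)

/-- The numerator
`n(u,v) = (1−γ)(q−γs₀²)(1−uv) + (1−q)(1−γξ₀s₀u)(1−γξ₀⁻¹s₀v)`. -/
def nEntry (q γ s0 ξ0 u v : ℂ) : ℂ :=
  (1 - γ) * (q - γ * s0 ^ 2) * (1 - u * v)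
    + (1 - q) * (1 - γ * ξ0 * s0 * u) * (1 - γ * ξ0⁻¹ * s0 * v)

/-- The normalized Izergin–Korepin type determinant
`E_n(u;v) = det[n(u_i,v_j) ∏_{l≠j}(1−u_i v_l)(1−q u_i v_l)] / (∏_{i<j}(u_i−u_j)(v_i−v_j))`. -/
def Efun (q γ s0 ξ0 : ℂ) {n : ℕ} (u v : Fin n → ℂ) : ℂ :=
  Matrix.det (Matrix.of fun i j : Fin n =>
      nEntry q γ s0 ξ0 (u i) (v j)
        * ∏ l ∈ Finset.univ.erase j, (1 - u i * v l) * (1 - q * u i * v l))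
    / (vandP u * vandP v)

theorem vandP_succ {n : ℕ} (w : Fin (n + 1) → ℂ) :
    vandP w = (∏ i : Fin n, (w 0 - w i.succ)) * vandP (fun i => w i.succ) := by
  simp only [vandP, Finset.prod_filter, Fintype.prod_prod_type]
  simp [Fin.prod_univ_succ]

theorem vandP_ne_zero {n : ℕ} {w : Fin n → ℂ} (hw : Function.Injective w) : vandP w ≠ 0 :=
  Finset.prod_ne_zero_iff.mpr fun _ hp =>
    sub_ne_zero.mpr (hw.ne (Finset.mem_filter.mp hp).2.ne)

theorem nEntry_one_div (q γ s0 ξ0 : ℂ) {x : ℂ} (hx : x ≠ 0) :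
    nEntry q γ s0 ξ0 (1 / x) x
      = (1 - q) * (1 - s0 * ξ0 * γ / x) * (1 - s0 * ξ0⁻¹ * γ * x) := by
  rw [nEntry, one_div_mul_cancel hx]
  ring

theorem Fin.prod_erase_zero {n : ℕ} (f : Fin (n + 1) → ℂ) :
    ∏ l ∈ Finset.univ.erase 0, f l = ∏ l : Fin n, f l.succ := by
  rw [Fin.univ_succ, Finset.erase_cons, Finset.prod_map]
  rfl

theorem Fin.prod_erase_succ {n : ℕ} (f : Fin (n + 1) → ℂ) (j : Fin n) :
    ∏ l ∈ Finset.univ.erase j.succ, f l = f 0 * ∏ l ∈ Finset.univ.erase j, f l.succ := by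
  simp_rw [← Finset.filter_ne', Finset.prod_filter, Fin.prod_univ_succ]
  simp [(Fin.succ_ne_zero _).symm]

/-- If `u₀ v₀ = 1`, the first row of the determinant vanishes off the diagonal. -/
theorem det_cons_one_div {M : ℕ} (q γ s0 ξ0 : ℂ) (v : Fin (M + 1) → ℂ) (hv1 : v 0 ≠ 0)
    (ut : Fin M → ℂ) :
    let u : Fin (M + 1) → ℂ := Fin.cons (1 / v 0) ut
    Matrix.det (Matrix.of fun i j : Fin (M + 1) =>
      nEntry q γ s0 ξ0 (u i) (v j)
        * ∏ l ∈ Finset.univ.erase j, (1 - u i * v l) * (1 - q * u i * v l))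
    = nEntry q γ s0 ξ0 (1 / v 0) (v 0)
      * (∏ l : Fin M, (1 - 1 / v 0 * v l.succ) * (1 - q * (1 / v 0) * v l.succ))
      * ((∏ i : Fin M, (1 - ut i * v 0) * (1 - q * ut i * v 0))
      * Matrix.det (Matrix.of fun i j : Fin M =>
        nEntry q γ s0 ξ0 (ut i) (v j.succ)
          * ∏ l ∈ Finset.univ.erase j, (1 - ut i * v l.succ) * (1 - q * ut i * v l.succ))) := by
  intro u
  rw [Matrix.det_succ_row_zero, Fin.sum_univ_succ, Finset.sum_eq_zero, add_zero,
    ← Matrix.det_mul_column]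
  · simp only [Matrix.of_apply, Fin.prod_erase_zero, u, Fin.cons_zero, Fin.val_zero, pow_zero,
      one_mul]
    congr 2
    ext i j
    simp only [Matrix.submatrix_apply, Matrix.of_apply, Fin.succAbove_zero, Fin.cons_succ,
      Fin.prod_erase_succ]
    ring
  · intro j _
    simp [Fin.prod_erase_succ, u, hv1]

/-- Recurrence property of the Izergin–Korepin type determinant
(Property 3 of Properties 3.1, verified in the proof of Proposition 3.4). -/
theorem IK_det_recurrence
    (M : ℕ) (hM : 1 ≤ M) (q γ s0 ξ0 : ℂ) (hξ : ξ0 ≠ 0)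
    (v : Fin (M + 1) → ℂ) (hv : Function.Injective v) (hv1 : v 0 ≠ 0)
    (ut : Fin M → ℂ) (hut : Function.Injective ut) (hune : ∀ i, ut i ≠ 1 / v 0) :
    Efun q γ s0 ξ0 (Fin.cons (1 / v 0) ut) v
    = (1 - q) * (1 - s0 * ξ0 * γ / v 0) * (1 - s0 * ξ0⁻¹ * γ * v 0)
        * (∏ j : Fin M, (1 - q * v j.succ / v 0) * (1 - q * v 0 * ut j))
        * Efun q γ s0 ξ0 ut (fun j => v j.succ) := by
  have hu : vandP (Fin.cons (1 / v 0) ut : Fin (M + 1) → ℂ)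
      = (∏ i : Fin M, (1 / v 0 - ut i)) * vandP ut := by
    simp [vandP_succ]
  have hA : ∏ i : Fin M, (1 / v 0 - ut i) ≠ 0 :=
    Finset.prod_ne_zero_iff.mpr fun i _ => sub_ne_zero.mpr (hune i).symm
  have hB : ∏ i : Fin M, (v 0 - v i.succ) ≠ 0 :=
    Finset.prod_ne_zero_iff.mpr fun i _ => sub_ne_zero.mpr (hv.ne (Fin.succ_ne_zero i).symm)
  have hV : vandP ut ≠ 0 := vandP_ne_zero hut
  have hW : vandP (fun j : Fin M => v j.succ) ≠ 0 :=
    vandP_ne_zero (hv.comp (Fin.succ_injective M))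
  have hP : (∏ l : Fin M, (1 - 1 / v 0 * v l.succ) * (1 - q * (1 / v 0) * v l.succ))
      * (∏ i : Fin M, (1 - ut i * v 0) * (1 - q * ut i * v 0))
      = (∏ j : Fin M, (1 - q * v j.succ / v 0) * (1 - q * v 0 * ut j))
        * ((∏ i : Fin M, (1 / v 0 - ut i)) * ∏ i : Fin M, (v 0 - v i.succ)) := by
    simp only [← Finset.prod_mul_distrib]
    refine Finset.prod_congr rfl fun i _ => ?_
    field_simp
  rw [Efun, Efun, det_cons_one_div q γ s0 ξ0 v hv1 ut, hu, vandP_succ v,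
    nEntry_one_div q γ s0 ξ0 hv1, ← mul_div_assoc _ _ (vandP ut * _), div_eq_div_iff
      (mul_ne_zero (mul_ne_zero hA hV) (mul_ne_zero hB hW)) (mul_ne_zero hV hW)]
  linear_combination (1 - q) * (1 - s0 * ξ0 * γ / v 0) * (1 - s0 * ξ0⁻¹ * γ * v 0)
    * Matrix.det (Matrix.of fun i j : Fin M =>
        nEntry q γ s0 ξ0 (ut i) (v j.succ)
          * ∏ l ∈ Finset.univ.erase j, (1 - ut i * v l.succ) * (1 - q * ut i * v l.succ))
    * (vandP ut * vandP (fun j : Fin M => v j.succ)) * hP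
end
end

section
/- Recurrence for the alternative determinant (Lemma 4.2). Let q, γ, s_0 ∈ ℂ and ξ_0 ∈ ℂ∖{0}. For n ≥ 1 and complex numbers u_1,…,u_n and pairwise distinct nonzero v_1,…,v_n, define m^{(n)}_i(v) = ξ_0^{2i−n} v^{n−i−1} [ (1−γs_0ξ_0^{−1}v)(ξ_0^{−1}v−γs_0) ∏_{l=1}^{n}(1−qvu_l) − γq^{n−i}(1−s_0ξ_0^{−1}v)(qξ_0^{−1}v−s_0) ∏_{l=1}^{n}(1−vu_l) ] and 𝓜_n(u_1,…,u_n | v_1,…,v_n) = det[m^{(n)}_i(v_j)]_{i,j=1}^n / ∏_{1≤i<j≤n}(v_i−v_j). Then for N ≥ 2, pairwise distinct nonzero v_1,…,v_N and any u_1,…,u_{N−1} ∈ ℂ, one has 𝓜_N(u_1,…,u_{N−1},1/v_N | v_1,…,v_N) = (1−q)(1−γs_0ξ_0/v_N)(1−γs_0ξ_0^{−1}v_N) · ∏_{j=1}^{N−1}(1−qv_j/v_N)(1−qv_Nu_j) · 𝓜_{N−1}(u_1,…,u_{N−1} | v_1,…,v_{N−1}). -/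
open scoped BigOperators

noncomputable section

/-- The matrix entry `m^{(n)}_i(v)` of Lemma 4.2 (1-based row index `i` is `(i:ℕ)+1`). -/
def mEntry (q γ s0 ξ0 : ℂ) {n : ℕ} (u : Fin n → ℂ) (i : Fin n) (v : ℂ) : ℂ :=
  ξ0 ^ (2 * ((i : ℕ) : ℤ) + 2 - (n : ℤ)) * v ^ ((n : ℤ) - (i : ℕ) - 2)
    * ((1 - γ * s0 * ξ0⁻¹ * v) * (ξ0⁻¹ * v - γ * s0) * ∏ l : Fin n, (1 - q * v * u l)
        - γ * q ^ (n - 1 - (i : ℕ)) * (1 - s0 * ξ0⁻¹ * v) * (q * ξ0⁻¹ * v - s0)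
            * ∏ l : Fin n, (1 - v * u l))

/-- `𝓜_n(u|v) = det[m^{(n)}_i(v_j)] / ∏_{i<j}(v_i−v_j)`. -/
def Mdet (q γ s0 ξ0 : ℂ) {n : ℕ} (u v : Fin n → ℂ) : ℂ :=
  Matrix.det (Matrix.of fun i j : Fin n => mEntry q γ s0 ξ0 u i (v j)) / vandP v

theorem vandP_castSucc {n : ℕ} (w : Fin (n + 1) → ℂ) :
    vandP w = vandP (fun j : Fin n => w j.castSucc) * ∏ j : Fin n, (w j.castSucc - w (Fin.last n)) := by
  unfold vandP
  simp only [Finset.prod_filter, Fintype.prod_prod_type]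
  rw [Fin.prod_univ_castSucc]
  simp [Fin.prod_univ_castSucc, Finset.prod_mul_distrib, Fin.castSucc_lt_last,
    (Fin.castSucc_lt_last _).not_gt]

/-- Adding to each row a multiple of the next row preserves the determinant. -/
theorem Matrix.det_eq_of_forall_row_eq_smul_add_succ {R : Type*} [CommRing R] {n : ℕ}
    {A B : Matrix (Fin (n + 1)) (Fin (n + 1)) R} (c : Fin n → R)
    (hlast : ∀ j, A (Fin.last n) j = B (Fin.last n) j)
    (hcast : ∀ (i : Fin n) j, A i.castSucc j = B i.castSucc j + c i * A i.succ j) :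
    A.det = B.det := by
  rw [← Matrix.det_submatrix_equiv_self Fin.revPerm A,
    ← Matrix.det_submatrix_equiv_self Fin.revPerm B]
  refine Matrix.det_eq_of_forall_row_eq_smul_add_pred (fun i => c i.rev) (fun j => ?_)
    (fun i j => ?_)
  · simp [hlast]
  · simp [Fin.rev_succ, Fin.rev_castSucc, hcast]

/-- If the last column vanishes off the diagonal, the determinant is a principal minor times the
corner entry. -/
theorem Matrix.det_of_last_column_eq_zero {R : Type*} [CommRing R] {n : ℕ}
    (B : Matrix (Fin (n + 1)) (Fin (n + 1)) R)
    (h : ∀ i : Fin n, B i.castSucc (Fin.last n) = 0) :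
    B.det = B (Fin.last n) (Fin.last n) *
      (Matrix.of fun i j : Fin n => B i.castSucc j.castSucc).det := by
  rw [Matrix.det_succ_column B (Fin.last n), Fin.sum_univ_castSucc]
  simp only [h, mul_zero, zero_mul, Finset.sum_const_zero, zero_add, Fin.succAbove_last,
    Fin.val_last, ← two_mul, pow_mul, neg_one_sq, one_pow, one_mul]
  rfl

theorem mEntry_snoc_last {M : ℕ} (q γ s0 : ℂ) {ξ0 w : ℂ} (hξ : ξ0 ≠ 0) (hw : w ≠ 0)
    (u : Fin M → ℂ) :
    mEntry q γ s0 ξ0 (Fin.snoc u (1 / w) : Fin (M + 1) → ℂ) (Fin.last M) w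
      = ξ0 ^ M * ((1 - q) * (1 - γ * s0 * ξ0 / w) * (1 - γ * s0 * ξ0⁻¹ * w)
        * ∏ l : Fin M, (1 - q * w * u l)) := by
  have h1 : 2 * (M : ℤ) + 2 - ((M + 1 : ℕ) : ℤ) = (M : ℤ) + 1 := by push_cast; ring
  have h2 : ((M + 1 : ℕ) : ℤ) - (M : ℤ) - 2 = -1 := by push_cast; ring
  simp only [mEntry, Fin.prod_univ_castSucc, Fin.snoc_castSucc, Fin.snoc_last, Fin.val_last,
    h1, h2, zpow_add₀ hξ, zpow_natCast, zpow_one, zpow_neg]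
  field_simp
  ring

theorem mEntry_snoc_castSucc {M : ℕ} (q γ s0 : ℂ) {ξ0 w x : ℂ} (hξ : ξ0 ≠ 0) (hw : w ≠ 0)
    (hx : x ≠ 0) (u : Fin M → ℂ) (i : Fin M) :
    mEntry q γ s0 ξ0 (Fin.snoc u (1 / w) : Fin (M + 1) → ℂ) i.castSucc x
      = (x - w) * ((1 - q * x / w) * ξ0⁻¹) * mEntry q γ s0 ξ0 u i x
        + w / ξ0 ^ 2 * mEntry q γ s0 ξ0 (Fin.snoc u (1 / w) : Fin (M + 1) → ℂ) i.succ x := by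
  have h1 : 2 * ((i : ℕ) : ℤ) + 2 - ((M + 1 : ℕ) : ℤ) = (2 * ((i : ℕ) : ℤ) + 2 - (M : ℤ)) - 1 := by
    push_cast; ring
  have h2 : ((M + 1 : ℕ) : ℤ) - ((i : ℕ) : ℤ) - 2 = ((M : ℤ) - ((i : ℕ) : ℤ) - 2) + 1 := by
    push_cast; ring
  have h3 : 2 * (((i : ℕ) + 1 : ℕ) : ℤ) + 2 - ((M + 1 : ℕ) : ℤ)
      = (2 * ((i : ℕ) : ℤ) + 2 - (M : ℤ)) + 1 := by
    push_cast; ring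
  have h4 : ((M + 1 : ℕ) : ℤ) - (((i : ℕ) + 1 : ℕ) : ℤ) - 2 = (M : ℤ) - ((i : ℕ) : ℤ) - 2 := by
    push_cast; ring
  have h5 : M + 1 - 1 - (i : ℕ) = (M - 1 - (i : ℕ)) + 1 := by omega
  have h6 : M + 1 - 1 - ((i : ℕ) + 1) = M - 1 - (i : ℕ) := by omega
  simp only [mEntry, Fin.prod_univ_castSucc, Fin.snoc_castSucc, Fin.snoc_last, Fin.val_castSucc,
    Fin.val_succ, h1, h2, h3, h4, h5, h6, zpow_add₀ hξ, zpow_add₀ hx, zpow_sub_one₀ hξ, zpow_one,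
    pow_succ q]
  generalize ξ0 ^ (2 * ((i : ℕ) : ℤ) + 2 - (M : ℤ)) = a
  generalize x ^ ((M : ℤ) - ((i : ℕ) : ℤ) - 2) = b
  field_simp
  ring

/-- Recurrence for the alternative determinant (Lemma 4.2). -/
theorem alternative_det_recurrence
    (M : ℕ) (hM : 1 ≤ M) (q γ s0 ξ0 : ℂ) (hξ : ξ0 ≠ 0)
    (v : Fin (M + 1) → ℂ) (hv : Function.Injective v) (hv0 : ∀ j, v j ≠ 0)
    (u : Fin M → ℂ) :
    Mdet q γ s0 ξ0 (Fin.snoc u (1 / v (Fin.last M))) v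
    = (1 - q) * (1 - γ * s0 * ξ0 / v (Fin.last M)) * (1 - γ * s0 * ξ0⁻¹ * v (Fin.last M))
        * (∏ j : Fin M, (1 - q * v j.castSucc / v (Fin.last M)) * (1 - q * v (Fin.last M) * u j))
        * Mdet q γ s0 ξ0 u (fun j => v j.castSucc) := by
  have hw := hv0 (Fin.last M)
  set w := v (Fin.last M) with hwdef
  let A : Matrix (Fin (M + 1)) (Fin (M + 1)) ℂ :=
    Matrix.of fun i j => mEntry q γ s0 ξ0 (Fin.snoc u (1 / w) : Fin (M + 1) → ℂ) i (v j)
  let B : Matrix (Fin (M + 1)) (Fin (M + 1)) ℂ :=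
    Matrix.of fun i j => Fin.lastCases (motive := fun _ => ℂ) (A (Fin.last M) j)
      (fun k : Fin M => (v j - w) * ((1 - q * v j / w) * ξ0⁻¹) * mEntry q γ s0 ξ0 u k (v j)) i
  have hAB : A.det = B.det := by
    refine Matrix.det_eq_of_forall_row_eq_smul_add_succ (fun _ => w / ξ0 ^ 2) (fun j => ?_)
      (fun i j => ?_)
    · simp [B]
    · simpa [A, B] using mEntry_snoc_castSucc q γ s0 hξ hw (hv0 j) u i
  have hB : B.det = A (Fin.last M) (Fin.last M) *
      ((∏ j : Fin M, (v j.castSucc - w) * ((1 - q * v j.castSucc / w) * ξ0⁻¹)) *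
        (Matrix.of fun i j : Fin M => mEntry q γ s0 ξ0 u i (v j.castSucc)).det) := by
    rw [Matrix.det_of_last_column_eq_zero B (fun i => by simp [B, hwdef]), ← Matrix.det_mul_row]
    simp [B]
  have hA : A (Fin.last M) (Fin.last M) = _ := mEntry_snoc_last q γ s0 hξ hw u
  have hd : ∏ j : Fin M, (v j.castSucc - w) ≠ 0 :=
    Finset.prod_ne_zero_iff.mpr fun j _ => sub_ne_zero.mpr (hv.ne (Fin.castSucc_ne_last j))
  have hd' : vandP (fun j : Fin M => v j.castSucc) ≠ 0 :=
    vandP_ne_zero (hv.comp (Fin.castSucc_injective M))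
  change A.det / vandP v = _
  rw [hAB, hB, hA, vandP_castSucc, ← hwdef, Mdet]
  simp only [Finset.prod_mul_distrib, Finset.prod_const, Finset.card_univ, Fintype.card_fin,
    inv_pow]
  generalize ∏ j : Fin M, (v j.castSucc - w) = d at *
  generalize ∏ j : Fin M, (1 - q * v j.castSucc / w) = e
  generalize ∏ j : Fin M, (1 - q * w * u j) = f
  field_simp
end
end

section
/- Product evaluation at a geometric specialization (Lemma 4.3). Let q, γ, s_0 ∈ ℂ and ξ_0 ∈ ℂ with q ≠ 0 and s_0ξ_0γ ≠ 0, and let v_1,…,v_N be pairwise distinct nonzero complex numbers. With 𝓜_N(u_1,…,u_N | v_1,…,v_N) = det[ ξ_0^{2i−N} v_j^{N−i−1} ( (1−γs_0ξ_0^{−1}v_j)(ξ_0^{−1}v_j−γs_0) ∏_{l=1}^{N}(1−qv_ju_l) − γq^{N−i}(1−s_0ξ_0^{−1}v_j)(qξ_0^{−1}v_j−s_0) ∏_{l=1}^{N}(1−v_ju_l) ) ]_{i,j=1}^N / ∏_{1≤i<j≤N}(v_i−v_j), one has 𝓜_N( 1/(s_0ξ_0γ), q/(s_0ξ_0γ),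 …, q^{N−1}/(s_0ξ_0γ) | v_1,…,v_N ) = q^{N²} · ∏_{i,j=1}^N (1 − v_i q^{j−1}/(s_0ξ_0γ)) · ∏_{j=1}^N (1−γq^{1−j})(1−s_0²γq^{−j}). -/
open scoped BigOperators

noncomputable section

open Polynomial in
/-- The monic polynomial of degree `k` with roots `(s q ^ l)⁻¹` for `l < k`. -/
def geomPoly (q s : ℂ) (k : ℕ) : ℂ[X] :=
  ∏ l ∈ Finset.range k, (X - C (s * q ^ l)⁻¹)

lemma monic_geomPoly (q s : ℂ) (k : ℕ) : (geomPoly q s k).Monic :=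
  Polynomial.monic_prod_of_monic _ _ fun _ _ => Polynomial.monic_X_sub_C _

lemma natDegree_geomPoly (q s : ℂ) (k : ℕ) : (geomPoly q s k).natDegree = k := by
  rw [geomPoly, Polynomial.natDegree_prod_of_monic _ _ fun _ _ => Polynomial.monic_X_sub_C _]
  simp only [Polynomial.natDegree_X_sub_C, Finset.sum_const, Finset.card_range,
    smul_eq_mul, mul_one]

lemma eval_geomPoly_succ (q s x : ℂ) (k : ℕ) :
    (geomPoly q s (k + 1)).eval x = (geomPoly q s k).eval x * (x - (s * q ^ k)⁻¹) := by
  simp only [geomPoly, Finset.prod_range_succ, Polynomial.eval_mul, Polynomial.eval_sub,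
    Polynomial.eval_X, Polynomial.eval_C]

lemma geomPoly_eval_q_mul {q s : ℂ} (hq : q ≠ 0) (hs : s ≠ 0) (x : ℂ) (k : ℕ) :
    (1 - s * x) * (geomPoly q s k).eval (q * x)
      = (1 - s * q ^ k * x) * (geomPoly q s k).eval x := by
  induction k with
  | zero => simp [geomPoly]
  | succ k ih =>
    rw [eval_geomPoly_succ, eval_geomPoly_succ, ← mul_assoc, ih]
    field_simp
    ring

/-- The `q`-difference operator
`f ↦ x⁻¹ (γ (1 - s x) (s - q x) f (q x) - (1 - s γ x) (s γ - q ^ N x) f x)`. -/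
def qDiffOp (q γ s : ℂ) (N : ℕ) (f : ℂ → ℂ) (x : ℂ) : ℂ :=
  x⁻¹ * (γ * (1 - s * x) * (s - q * x) * f (q * x)
    - (1 - s * γ * x) * (s * γ - q ^ N * x) * f x)

lemma qDiffOp_sum {ι : Type*} (t : Finset ι) (q γ s : ℂ) (N : ℕ) (a : ι → ℂ) (f : ι → ℂ → ℂ)
    (x : ℂ) : qDiffOp q γ s N (fun y => ∑ i ∈ t, a i * f i y) x
      = ∑ i ∈ t, a i * qDiffOp q γ s N (f i) x := by
  simp only [qDiffOp, Finset.mul_sum, ← Finset.sum_sub_distrib]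
  exact Finset.sum_congr rfl fun i _ => by ring

lemma qDiffOp_geomPoly {q s : ℂ} (hq : q ≠ 0) (hs : s ≠ 0) (γ : ℂ) {N k : ℕ} (hk : k ≤ N)
    {x : ℂ} (hx : x ≠ 0) :
    qDiffOp q γ s N (fun y => (geomPoly q s k).eval y) x
      = (q ^ (N - k) - s ^ 2 * γ) * (q ^ k - γ) * (geomPoly q s k).eval x
        + s * γ * (q ^ (k + 1) - q ^ N) * (geomPoly q s (k + 1)).eval x := by
  obtain ⟨m, rfl⟩ := Nat.exists_eq_add_of_le hk
  have h := geomPoly_eval_q_mul hq hs x k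
  have h' : qDiffOp q γ s (k + m) (fun y => (geomPoly q s k).eval y) x
      = x⁻¹ * (γ * (s - q * x) * ((1 - s * q ^ k * x) * (geomPoly q s k).eval x)
        - (1 - s * γ * x) * (s * γ - q ^ (k + m) * x) * (geomPoly q s k).eval x) := by
    rw [← h, qDiffOp]
    ring
  rw [h', eval_geomPoly_succ, Nat.add_sub_cancel_left]
  field_simp
  ring

lemma det_qDiffOp_pow {q s : ℂ} (hq : q ≠ 0) (hs : s ≠ 0) (γ : ℂ) {N : ℕ}
    (x : Fin N → ℂ) (hx : ∀ j, x j ≠ 0) :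
    (Matrix.of fun m j : Fin N => qDiffOp q γ s N (fun y => y ^ (m : ℕ)) (x j)).det
      = (∏ k : Fin N, (q ^ (N - (k : ℕ)) - s ^ 2 * γ) * (q ^ (k : ℕ) - γ))
        * (Matrix.of fun m j : Fin N => x j ^ (m : ℕ)).det := by
  set U : Matrix (Fin N) (Fin N) ℂ := Matrix.of fun k m => (geomPoly q s k).coeff m with hU
  set T : Matrix (Fin N) (Fin N) ℂ := Matrix.of fun k l =>
    (if l = k then (q ^ (N - (k : ℕ)) - s ^ 2 * γ) * (q ^ (k : ℕ) - γ) else 0)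
      + (if (l : ℕ) = k + 1 then s * γ * (q ^ ((k : ℕ) + 1) - q ^ N) else 0) with hT
  have hUdet : U.det = 1 := by
    rw [Matrix.det_of_isLowerTriangular U]
    · refine Finset.prod_eq_one fun k _ => ?_
      have := (monic_geomPoly q s k).coeff_natDegree
      rwa [natDegree_geomPoly] at this
    · intro k m hkm
      exact Polynomial.coeff_eq_zero_of_natDegree_lt ((natDegree_geomPoly q s k).trans_lt hkm)
  have hTdet : T.det = ∏ k : Fin N, (q ^ (N - (k : ℕ)) - s ^ 2 * γ) * (q ^ (k : ℕ) - γ) := by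
    rw [Matrix.det_of_isUpperTriangular]
    · simp [hT]
    · intro k l hkl
      have h : (l : ℕ) < k := hkl
      rw [hT, Matrix.of_apply, if_neg (by rintro rfl; exact lt_irrefl _ h), if_neg (by omega),
        add_zero]
  have heval (k : Fin N) (y : ℂ) :
      (geomPoly q s k).eval y = ∑ m : Fin N, (geomPoly q s k).coeff m * y ^ (m : ℕ) := by
    rw [Polynomial.eval_eq_sum_range' (n := N) (by rw [natDegree_geomPoly]; exact k.2),
      Finset.sum_range]
  have hUV : U * (Matrix.of fun m j : Fin N => x j ^ (m : ℕ))
      = Matrix.of fun k j : Fin N => (geomPoly q s k).eval (x j) := by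
    ext k j
    simp [Matrix.mul_apply, hU, heval]
  have hmain : U * (Matrix.of fun m j : Fin N => qDiffOp q γ s N (fun y => y ^ (m : ℕ)) (x j))
      = T * (U * (Matrix.of fun m j : Fin N => x j ^ (m : ℕ))) := by
    rw [hUV]
    ext k j
    simp only [Matrix.mul_apply, hU, hT, Matrix.of_apply]
    rw [← qDiffOp_sum]
    simp only [← heval]
    rw [qDiffOp_geomPoly hq hs γ k.2.le (hx j)]
    simp only [add_mul, Finset.sum_add_distrib, ite_mul, zero_mul, Finset.sum_ite_eq',
      Finset.mem_univ, if_true]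
    congr 1
    rcases Nat.lt_or_ge ((k : ℕ) + 1) N with hk | hk
    · rw [Finset.sum_eq_single (⟨(k : ℕ) + 1, hk⟩ : Fin N)]
      · simp
      · intro l _ hl
        exact if_neg fun h => hl (Fin.ext h)
      · simp
    · have hkN : (k : ℕ) + 1 = N := by omega
      rw [Finset.sum_eq_zero fun l _ => if_neg (by omega), hkN]
      ring
  have := congrArg Matrix.det hmain
  rwa [Matrix.det_mul, Matrix.det_mul, Matrix.det_mul, hUdet, hTdet, one_mul, one_mul] at this

lemma det_reverse_rows {N : ℕ} (f : ℕ → Fin N → ℂ) :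
    (Matrix.of fun i j : Fin N => f (N - 1 - (i : ℕ)) j).det
      = (Equiv.Perm.sign (Fin.revPerm : Equiv.Perm (Fin N)) : ℂ)
        * (Matrix.of fun m j : Fin N => f (m : ℕ) j).det := by
  rw [← Matrix.det_permute]
  congr 1
  ext i j
  simp only [Matrix.submatrix_apply, Matrix.of_apply, Fin.revPerm_apply, Fin.val_rev, id]
  congr 1
  omega

lemma vandP_eq_det {N : ℕ} (v : Fin N → ℂ) :
    vandP v = (Matrix.of fun i j : Fin N => v j ^ (N - 1 - (i : ℕ))).det := by
  have h := Matrix.det_projVandermonde (fun _ : Fin N => (1 : ℂ)) v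
  rw [← Matrix.det_transpose] at h
  have h' : (Matrix.projVandermonde (fun _ : Fin N => (1 : ℂ)) v).transpose
      = Matrix.of fun i j : Fin N => v j ^ (N - 1 - (i : ℕ)) := by
    ext i j
    simp only [Matrix.transpose_apply, Matrix.projVandermonde_apply, one_pow, one_mul,
      Matrix.of_apply, Fin.val_rev]
    congr 1
    omega
  rw [← h', h, vandP, Finset.prod_filter, ← Finset.univ_product_univ, Finset.prod_product]
  refine Finset.prod_congr rfl fun i _ => ?_
  rw [← Finset.prod_filter, Finset.filter_lt_eq_Ioi]
  simp

lemma vandP_ne_zero_s8 {N : ℕ} {v : Fin N → ℂ} (hv : Function.Injective v) : vandP v ≠ 0 := by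
  refine Finset.prod_ne_zero_iff.mpr fun p hp => sub_ne_zero.mpr fun h => ?_
  exact (Finset.mem_filter.mp hp).2.ne (hv h)

lemma vandP_const_mul {N : ℕ} (ξ : ℂ) (x : Fin N → ℂ) :
    vandP (fun j => ξ * x j) = (∏ i : Fin N, ξ ^ (i : ℕ)) * vandP x := by
  have hrev : ∏ i : Fin N, ξ ^ (i : ℕ) = ∏ i : Fin N, ξ ^ (N - 1 - (i : ℕ)) := by
    rw [← Equiv.prod_comp Fin.revPerm]
    refine Finset.prod_congr rfl fun i _ => ?_
    rw [Fin.revPerm_apply, Fin.val_rev]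
    congr 1
    omega
  rw [vandP_eq_det, vandP_eq_det, hrev, ← Matrix.det_mul_column]
  simp only [mul_pow, Matrix.of_apply]

lemma prod_geom_shift (a q : ℂ) (N : ℕ) :
    (1 - a) * ∏ l : Fin N, (1 - a * q ^ ((l : ℕ) + 1))
      = (∏ l : Fin N, (1 - a * q ^ (l : ℕ))) * (1 - a * q ^ N) := by
  rw [← Finset.prod_range fun l => 1 - a * q ^ (l + 1), ← Finset.prod_range fun l => 1 - a * q ^ l,
    ← Finset.prod_range_succ, Finset.prod_range_succ']
  simp [mul_comm]

lemma mEntry_geometric {N : ℕ} {q γ s ξ v : ℂ} (h0 : s * ξ * γ ≠ 0) (hv : v ≠ 0) (i : Fin N) :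
    mEntry q γ s ξ (fun j : Fin N => q ^ (j : ℕ) / (s * ξ * γ)) i v
      = (∏ j : Fin N, (1 - v * q ^ (j : ℕ) / (s * ξ * γ)))
        * (ξ ^ (i : ℕ) * qDiffOp q γ s N (fun y => y ^ (N - 1 - (i : ℕ))) (v / ξ)) := by
  have hγ : γ ≠ 0 := right_ne_zero_of_mul h0
  have hξ : ξ ≠ 0 := right_ne_zero_of_mul (left_ne_zero_of_mul h0)
  have hs : s ≠ 0 := left_ne_zero_of_mul (left_ne_zero_of_mul h0)
  obtain ⟨m, hm⟩ : ∃ m, N = m + i + 1 := ⟨N - 1 - i, by omega⟩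
  have hm' : N - 1 - (i : ℕ) = m := by omega
  obtain ⟨x, rfl⟩ : ∃ x, v = ξ * x := ⟨v / ξ, by field_simp⟩
  have hx : x ≠ 0 := right_ne_zero_of_mul hv
  have hshift := prod_geom_shift (ξ * x / (s * ξ * γ)) q N
  have hP : ∏ l : Fin N, (1 - ξ * x * (q ^ (l : ℕ) / (s * ξ * γ)))
      = ∏ l : Fin N, (1 - ξ * x / (s * ξ * γ) * q ^ (l : ℕ)) :=
    Finset.prod_congr rfl fun l _ => by ring
  have hP' : ∏ l : Fin N, (1 - ξ * x * q ^ (l : ℕ) / (s * ξ * γ))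
      = ∏ l : Fin N, (1 - ξ * x / (s * ξ * γ) * q ^ (l : ℕ)) :=
    Finset.prod_congr rfl fun l _ => by ring
  have hQ : ∏ l : Fin N, (1 - q * (ξ * x) * (q ^ (l : ℕ) / (s * ξ * γ)))
      = ∏ l : Fin N, (1 - ξ * x / (s * ξ * γ) * q ^ ((l : ℕ) + 1)) :=
    Finset.prod_congr rfl fun l _ => by ring
  have hpow : ξ ^ (2 * ((i : ℕ) : ℤ) + 2 - (N : ℤ)) * (ξ * x) ^ ((N : ℤ) - (i : ℕ) - 2)
      = ξ ^ (i : ℕ) * (x⁻¹ * x ^ m) := by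
    rw [mul_zpow, ← mul_assoc, ← zpow_add₀ hξ,
      show 2 * ((i : ℕ) : ℤ) + 2 - (N : ℤ) + ((N : ℤ) - (i : ℕ) - 2) = (i : ℕ) by ring,
      show (N : ℤ) - (i : ℕ) - 2 = -1 + (m : ℤ) by omega,
      zpow_add₀ hx, zpow_neg_one, zpow_natCast, zpow_natCast]
  rw [mEntry, hP, hP', hQ, hpow, hm', qDiffOp]
  set P := ∏ l : Fin N, (1 - ξ * x / (s * ξ * γ) * q ^ (l : ℕ))
  set Q := ∏ l : Fin N, (1 - ξ * x / (s * ξ * γ) * q ^ ((l : ℕ) + 1))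
  have hx' : ξ * x / ξ = x := by field_simp
  have hξx (a : ℂ) : a * ξ⁻¹ * (ξ * x) = a * x := by field_simp
  have hξx' : ξ⁻¹ * (ξ * x) = x := by field_simp
  have hfac : (x - γ * s) * Q = -(s * γ - q ^ N * x) * P := by
    have h1 : x - γ * s = -(s * γ) * (1 - ξ * x / (s * ξ * γ)) := by field_simp; ring
    rw [h1, mul_assoc, hshift]
    field_simp
  rw [hx', hξx, hξx, hξx, hξx', mul_assoc (1 - γ * s * x), hfac]
  ring

lemma prod_eigenvalues {q : ℂ} (hq : q ≠ 0) (γ s : ℂ) (N : ℕ) :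
    ∏ k : Fin N, (q ^ (N - (k : ℕ)) - s ^ 2 * γ) * (q ^ (k : ℕ) - γ)
      = q ^ (N ^ 2) * ∏ j : Fin N,
          (1 - γ * q ^ (-((j : ℕ) : ℤ))) * (1 - s ^ 2 * γ * q ^ (-((j : ℕ) : ℤ) - 1)) := by
  have hrev : ∏ k : Fin N, (q ^ (N - (k : ℕ)) - s ^ 2 * γ)
      = ∏ k : Fin N, (q ^ ((k : ℕ) + 1) - s ^ 2 * γ) := by
    rw [← Equiv.prod_comp Fin.revPerm]
    refine Finset.prod_congr rfl fun i _ => ?_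
    rw [Fin.revPerm_apply, Fin.val_rev]
    congr 2
    omega
  have hpow : q ^ (N ^ 2) = ∏ j : Fin N, q ^ (2 * (j : ℕ) + 1) := by
    rw [← Finset.prod_range fun j => q ^ (2 * j + 1), Finset.prod_pow_eq_pow_sum]
    congr 1
    clear hrev
    induction N with
    | zero => simp
    | succ n ih =>
      rw [Finset.sum_range_succ, ← ih]
      ring
  rw [Finset.prod_mul_distrib, hrev, ← Finset.prod_mul_distrib, hpow, ← Finset.prod_mul_distrib]
  refine Finset.prod_congr rfl fun j _ => ?_
  rw [zpow_sub₀ hq, zpow_neg, zpow_natCast, zpow_one]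
  field_simp
  ring

/-- Product evaluation at a geometric specialization (Lemma 4.3). -/
theorem product_evaluation_geometric
    (N : ℕ) (hN : 1 ≤ N) (q γ s0 ξ0 : ℂ) (hq : q ≠ 0) (h0 : s0 * ξ0 * γ ≠ 0)
    (v : Fin N → ℂ) (hv : Function.Injective v) (hv0 : ∀ j, v j ≠ 0) :
    Mdet q γ s0 ξ0 (fun j : Fin N => q ^ (j : ℕ) / (s0 * ξ0 * γ)) v
    = q ^ (N ^ 2)
        * (∏ i : Fin N, ∏ j : Fin N, (1 - v i * q ^ (j : ℕ) / (s0 * ξ0 * γ)))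
        * ∏ j : Fin N,
            (1 - γ * q ^ (-((j : ℕ) : ℤ))) * (1 - s0 ^ 2 * γ * q ^ (-((j : ℕ) : ℤ) - 1)) := by
  have hξ : ξ0 ≠ 0 := right_ne_zero_of_mul (left_ne_zero_of_mul h0)
  have hs : s0 ≠ 0 := left_ne_zero_of_mul (left_ne_zero_of_mul h0)
  have hvand : vandP v = (∏ i : Fin N, ξ0 ^ (i : ℕ)) * vandP (fun j => v j / ξ0) := by
    rw [← vandP_const_mul]
    congr 1
    ext j
    field_simp
  rw [Mdet, div_eq_iff (vandP_ne_zero_s8 hv)]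
  simp only [mEntry_geometric h0 (hv0 _)]
  have hrow := Matrix.det_mul_row (fun j => ∏ l : Fin N, (1 - v j * q ^ (l : ℕ) / (s0 * ξ0 * γ)))
    (Matrix.of fun i j : Fin N =>
      ξ0 ^ (i : ℕ) * qDiffOp q γ s0 N (fun y => y ^ (N - 1 - (i : ℕ))) (v j / ξ0))
  have hcol := Matrix.det_mul_column (fun i : Fin N => ξ0 ^ (i : ℕ))
    (Matrix.of fun i j : Fin N => qDiffOp q γ s0 N (fun y => y ^ (N - 1 - (i : ℕ))) (v j / ξ0))
  simp only [Matrix.of_apply] at hrow hcol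
  rw [hrow, hcol, det_reverse_rows fun m j => qDiffOp q γ s0 N (fun y => y ^ m) (v j / ξ0),
    det_qDiffOp_pow hq hs γ _ fun j => div_ne_zero (hv0 j) hξ,
    prod_eigenvalues hq, hvand, vandP_eq_det, det_reverse_rows fun m j => (v j / ξ0) ^ m]
  ring
end
end
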